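/- arXiv:1804.02425 — 6 statements merged into one kernel-verified Lean document; each statement's English description precedes it below -/
import Mathlib

section
/- Under the H-CADMM recursion, for every k ≥ 0 the primal iterates satisfy x^{k+1} = −(1/ρ) D⁻¹ ∇F(x^{k+1}) + D⁻¹ C E⁻¹ Cᵀ x^k − D⁻¹ (D − C E⁻¹ Cᵀ) Σ_{t=0}^{k} x^t. -/
open Matrix

/-- Lemma 2 of the H-CADMM paper: under the H-CADMM recursion, the primal iterates
satisfy `x^{k+1} = -(1/ρ)D⁻¹∇F(x^{k+1}) + D⁻¹CE⁻¹Cᵀ x^k - D⁻¹(D - CE⁻¹Cᵀ) Σ_{t=0}^k x^t`. -/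
theorem stmt_5 (N M : ℕ) (C : Matrix (Fin N) (Fin M) ℝ)
    (hC01 : ∀ i j, C i j = 0 ∨ C i j = 1)
    (hd : ∀ i, 0 < ∑ j, C i j)
    (he : ∀ j, 0 < ∑ i, C i j)
    (D : Matrix (Fin N) (Fin N) ℝ) (hD : D = Matrix.diagonal fun i => ∑ j, C i j)
    (E : Matrix (Fin M) (Fin M) ℝ) (hE : E = Matrix.diagonal fun j => ∑ i, C i j)
    (ρ : ℝ) (hρ : 0 < ρ)
    (F : (Fin N → ℝ) → ℝ) (gradF : (Fin N → ℝ) → Fin N → ℝ)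
    (hFdiff : Differentiable ℝ F)
    (hgrad : ∀ x v, fderiv ℝ F x v = ∑ i, gradF x i * v i)
    (x : ℕ → Fin N → ℝ) (z : ℕ → Fin M → ℝ) (y : ℕ → Fin N → ℝ)
    (hx : ∀ k : ℕ, gradF (x (k + 1)) + ρ • D.mulVec (x (k + 1))
      = ρ • C.mulVec (z k) - y k)
    (hz : ∀ k : ℕ, z k = E⁻¹.mulVec (Cᵀ.mulVec (x k)))
    (hy : ∀ k : ℕ, y (k + 1) = y k + ρ • (D.mulVec (x (k + 1)) - C.mulVec (z (k + 1))))
    (hy0 : y 0 = ρ • (D - C * E⁻¹ * Cᵀ).mulVec (x 0)) :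
    ∀ k : ℕ, x (k + 1) =
      -((1 / ρ) • D⁻¹.mulVec (gradF (x (k + 1))))
      + D⁻¹.mulVec ((C * E⁻¹ * Cᵀ).mulVec (x k))
      - D⁻¹.mulVec ((D - C * E⁻¹ * Cᵀ).mulVec (∑ t ∈ Finset.range (k + 1), x t)) := by
  have hCz : ∀ k, C.mulVec (z k) = (C * E⁻¹ * Cᵀ).mulVec (x k) := fun k => by
    rw [hz, mulVec_mulVec, mulVec_mulVec, Matrix.mul_assoc]
  have hDdet : IsUnit D.det := by
    rw [hD, det_diagonal, isUnit_iff_ne_zero]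
    exact Finset.prod_ne_zero_iff.mpr fun i _ => (hd i).ne'
  have hDinv : ∀ v, D⁻¹.mulVec (D.mulVec v) = v := fun v => by
    rw [mulVec_mulVec, nonsing_inv_mul D hDdet, one_mulVec]
  have hy_sum : ∀ k, y k =
      ρ • (D - C * E⁻¹ * Cᵀ).mulVec (∑ t ∈ Finset.range (k + 1), x t) := fun k => by
    induction k with
    | zero => simpa using hy0
    | succ k ih =>
      rw [hy, ih, hCz, Finset.sum_range_succ _ (k + 1), mulVec_add, smul_add, ← sub_mulVec]
  intro k
  have hDx : D.mulVec (x (k + 1)) = -((1 / ρ) • gradF (x (k + 1)))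
      + (C * E⁻¹ * Cᵀ).mulVec (x k)
      - (D - C * E⁻¹ * Cᵀ).mulVec (∑ t ∈ Finset.range (k + 1), x t) := by
    have h := hx k
    rw [hCz, hy_sum] at h
    ext i
    have hi := congrFun h i
    simp only [Pi.add_apply, Pi.sub_apply, Pi.neg_apply, Pi.smul_apply, smul_eq_mul] at hi ⊢
    field_simp
    linarith
  calc x (k + 1) = D⁻¹.mulVec (D.mulVec (x (k + 1))) := (hDinv _).symm
    _ = _ := by rw [hDx, mulVec_sub, mulVec_add, mulVec_neg, mulVec_smul]
end

section
/- Under the H-CADMM recursion, if moreover x* ∈ ℝ^N and r* ∈ ℝ^N satisfy ∇F(x*) = −ρ Q r*, then for every k ≥ 0: C E⁻¹ Cᵀ (x^{k+1} − x^k) = −Q (r^{k+1} − r*) − (1/ρ) (∇F(x^{k+1}) − ∇F(x*)), where r^k := Σ_{t=0}^{k} Q x^t. -/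
open Matrix

/-- Lemma 5 of the H-CADMM paper: under the H-CADMM recursion, if the KKT pair
`(x*, r*)` satisfies `∇F(x*) = -ρ Q r*` (with `Q` the PSD square root of
`D - CE⁻¹Cᵀ`), then `CE⁻¹Cᵀ(x^{k+1} - x^k) = -Q(r^{k+1} - r*) - (1/ρ)(∇F(x^{k+1}) - ∇F(x*))`,
where `r^k = Σ_{t=0}^k Q x^t`. -/
theorem stmt_6 (N M : ℕ) (C : Matrix (Fin N) (Fin M) ℝ)
    (hC01 : ∀ i j, C i j = 0 ∨ C i j = 1)
    (hd : ∀ i, 0 < ∑ j, C i j)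
    (he : ∀ j, (2 : ℝ) ≤ ∑ i, C i j)
    (D : Matrix (Fin N) (Fin N) ℝ) (hD : D = Matrix.diagonal fun i => ∑ j, C i j)
    (E : Matrix (Fin M) (Fin M) ℝ) (hE : E = Matrix.diagonal fun j => ∑ i, C i j)
    (Q : Matrix (Fin N) (Fin N) ℝ)
    (hQpsd : Q.PosSemidef) (hQsq : Q * Q = D - C * E⁻¹ * Cᵀ)
    (ρ : ℝ) (hρ : 0 < ρ)
    (F : (Fin N → ℝ) → ℝ) (gradF : (Fin N → ℝ) → Fin N → ℝ)
    (hFdiff : Differentiable ℝ F)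
    (hgrad : ∀ x v, fderiv ℝ F x v = ∑ i, gradF x i * v i)
    (x : ℕ → Fin N → ℝ) (z : ℕ → Fin M → ℝ) (y : ℕ → Fin N → ℝ)
    (hx : ∀ k : ℕ, gradF (x (k + 1)) + ρ • D.mulVec (x (k + 1))
      = ρ • C.mulVec (z k) - y k)
    (hz : ∀ k : ℕ, z k = E⁻¹.mulVec (Cᵀ.mulVec (x k)))
    (hy : ∀ k : ℕ, y (k + 1) = y k + ρ • (D.mulVec (x (k + 1)) - C.mulVec (z (k + 1))))
    (hy0 : y 0 = ρ • (D - C * E⁻¹ * Cᵀ).mulVec (x 0))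
    (xstar rstar : Fin N → ℝ)
    (hKKT : gradF xstar = -(ρ • Q.mulVec rstar)) :
    ∀ k : ℕ, (C * E⁻¹ * Cᵀ).mulVec (x (k + 1) - x k)
      = -(Q.mulVec ((∑ t ∈ Finset.range (k + 2), Q.mulVec (x t)) - rstar))
        - (1 / ρ) • (gradF (x (k + 1)) - gradF xstar) := by
  have hCz : ∀ k, C.mulVec (z k) = (C * E⁻¹ * Cᵀ).mulVec (x k) := fun k => by
    simp only [hz, mulVec_mulVec, Matrix.mul_assoc]
  have hQQ : ∀ v, Q.mulVec (Q.mulVec v) = D.mulVec v - (C * E⁻¹ * Cᵀ).mulVec v := fun v => by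
    rw [mulVec_mulVec, hQsq, sub_mulVec]
  have hyr : ∀ k, y k = ρ • Q.mulVec (∑ t ∈ Finset.range (k + 1), Q.mulVec (x t)) := by
    intro k
    induction k with
    | zero => simp [hy0, hQQ, sub_mulVec]
    | succ k ih =>
      rw [hy, ih, Finset.sum_range_succ _ (k + 1), mulVec_add, hQQ, hCz, smul_add]
  intro k
  have hstep := hx k
  rw [hyr, hCz] at hstep
  rw [hKKT, Finset.sum_range_succ _ (k + 1), mulVec_sub, mulVec_sub, mulVec_add, hQQ,
    eq_sub_of_add_eq hstep]
  ext i
  simp only [Pi.sub_apply, Pi.add_apply, Pi.neg_apply, Pi.smul_apply, smul_eq_mul]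
  field_simp
  ring
end

section
/- Suppose every column of C sums to exactly 2 (so E = 2 I_M). Then any sequences x^k ∈ ℝ^N, z^k ∈ ℝ^M, y^k ∈ ℝ^N satisfying the H-CADMM updates z^{k+1} = E⁻¹ Cᵀ x^{k+1}, ∇F(x^{k+1}) + ρ D x^{k+1} = ρ C z^k − y^k, and y^{k+1} = y^k + ρ(D x^{k+1} − C z^{k+1}) also satisfy the decentralized consensus ADMM updates ∇F(x^{k+1}) + ρ D x^{k+1} = (ρ/2) C Cᵀ x^k − y^k and y^{k+1} = y^k + ρ (D − (1/2) C Cᵀ) x^{k+1}. -/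
open Matrix

/-- Proposition 2 of the H-CADMM paper: when every hyperedge has degree exactly 2
(so `E = 2I`), the H-CADMM updates imply the decentralized consensus ADMM updates
`∇F(x^{k+1}) + ρDx^{k+1} = (ρ/2)CCᵀx^k − y^k` and
`y^{k+1} = y^k + ρ(D − (1/2)CCᵀ)x^{k+1}`. -/
theorem stmt_14 (N M : ℕ) (C : Matrix (Fin N) (Fin M) ℝ)
    (hC01 : ∀ i j, C i j = 0 ∨ C i j = 1)
    (he2 : ∀ j, ∑ i, C i j = (2 : ℝ))
    (D : Matrix (Fin N) (Fin N) ℝ) (hD : D = Matrix.diagonal fun i => ∑ j, C i j)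
    (E : Matrix (Fin M) (Fin M) ℝ) (hE : E = Matrix.diagonal fun j => ∑ i, C i j)
    (ρ : ℝ) (hρ : 0 < ρ)
    (F : (Fin N → ℝ) → ℝ) (gradF : (Fin N → ℝ) → Fin N → ℝ)
    (hFdiff : Differentiable ℝ F)
    (hgrad : ∀ x v, fderiv ℝ F x v = ∑ i, gradF x i * v i)
    (x : ℕ → Fin N → ℝ) (z : ℕ → Fin M → ℝ) (y : ℕ → Fin N → ℝ)
    (hz : ∀ k : ℕ, z k = E⁻¹.mulVec (Cᵀ.mulVec (x k)))
    (hx : ∀ k : ℕ, gradF (x (k + 1)) + ρ • D.mulVec (x (k + 1))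
      = ρ • C.mulVec (z k) - y k)
    (hy : ∀ k : ℕ, y (k + 1) = y k + ρ • (D.mulVec (x (k + 1)) - C.mulVec (z (k + 1)))) :
    (∀ k : ℕ, gradF (x (k + 1)) + ρ • D.mulVec (x (k + 1))
      = (ρ / 2) • (C * Cᵀ).mulVec (x k) - y k) ∧
    (∀ k : ℕ, y (k + 1) = y k
      + ρ • (D - (1 / 2 : ℝ) • (C * Cᵀ)).mulVec (x (k + 1))) := by
  have hEinv : E⁻¹ = (1 / 2 : ℝ) • (1 : Matrix (Fin M) (Fin M) ℝ) := by
    apply Matrix.inv_eq_right_inv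
    ext i j
    simp [hE, he2, Matrix.one_apply]
  have hCz (k : ℕ) : C.mulVec (z k) = (1 / 2 : ℝ) • (C * Cᵀ).mulVec (x k) := by
    rw [hz, hEinv, Matrix.smul_mulVec, Matrix.one_mulVec, Matrix.mulVec_smul,
      Matrix.mulVec_mulVec]
  refine ⟨fun k => ?_, fun k => ?_⟩
  · rw [hx, hCz, smul_smul, mul_one_div]
  · rw [hy, hCz, Matrix.sub_mulVec, Matrix.smul_mulVec]
end

section
/- Under the H-CADMM recursion with KKT point (x*, r*) satisfying additionally Q x* = 0, for every k ≥ 0 the following identity holds: (2/ρ) (x^{k+1} − x*)ᵀ (∇F(x^{k+1}) − ∇F(x*)) = ‖q^k − q*‖_G² − ‖q^{k+1} − q*‖_G² − ‖q^{k+1} − q^k‖_G². -/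
open Matrix

theorem dotProduct_mulVec_comm_of_isSymm {n : Type*} [Fintype n] {S : Matrix n n ℝ}
    (hS : S.IsSymm) (u v : n → ℝ) : u ⬝ᵥ S *ᵥ v = v ⬝ᵥ S *ᵥ u := by
  rw [dotProduct_mulVec, ← mulVec_transpose, hS.eq, dotProduct_comm]

/-- The three-point identity for the quadratic form of a symmetric matrix. -/
theorem quadForm_three_point {n : Type*} [Fintype n] {S : Matrix n n ℝ}
    (hS : S.IsSymm) (a b c : n → ℝ) :
    (a - c) ⬝ᵥ S *ᵥ (a - c) - (b - c) ⬝ᵥ S *ᵥ (b - c) - (b - a) ⬝ᵥ S *ᵥ (b - a)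
      = -2 * ((b - c) ⬝ᵥ S *ᵥ (b - a)) := by
  have h₁ := dotProduct_mulVec_comm_of_isSymm hS a b
  have h₂ := dotProduct_mulVec_comm_of_isSymm hS a c
  have h₃ := dotProduct_mulVec_comm_of_isSymm hS b c
  simp only [mulVec_sub, sub_dotProduct, dotProduct_sub]
  linarith

/-- The key identity in the proof of Theorem 1 of the H-CADMM paper:
`(2/ρ)(x^{k+1} − x*)ᵀ(∇F(x^{k+1}) − ∇F(x*)) = ‖q^k − q*‖²_G − ‖q^{k+1} − q*‖²_G − ‖q^{k+1} − q^k‖²_G`. -/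
theorem stmt_17 (N M : ℕ) (C : Matrix (Fin N) (Fin M) ℝ)
    (hC01 : ∀ i j, C i j = 0 ∨ C i j = 1)
    (hd : ∀ i, 0 < ∑ j, C i j)
    (he : ∀ j, (2 : ℝ) ≤ ∑ i, C i j)
    (D : Matrix (Fin N) (Fin N) ℝ) (hD : D = Matrix.diagonal fun i => ∑ j, C i j)
    (E : Matrix (Fin M) (Fin M) ℝ) (hE : E = Matrix.diagonal fun j => ∑ i, C i j)
    (Q : Matrix (Fin N) (Fin N) ℝ)
    (hQpsd : Q.PosSemidef) (hQsq : Q * Q = D - C * E⁻¹ * Cᵀ)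
    (ρ : ℝ) (hρ : 0 < ρ)
    (F : (Fin N → ℝ) → ℝ) (gradF : (Fin N → ℝ) → Fin N → ℝ)
    (hFdiff : Differentiable ℝ F)
    (hgrad : ∀ x v, fderiv ℝ F x v = ∑ i, gradF x i * v i)
    (x : ℕ → Fin N → ℝ) (z : ℕ → Fin M → ℝ) (y : ℕ → Fin N → ℝ)
    (hx : ∀ k : ℕ, gradF (x (k + 1)) + ρ • D.mulVec (x (k + 1))
      = ρ • C.mulVec (z k) - y k)
    (hz : ∀ k : ℕ, z k = E⁻¹.mulVec (Cᵀ.mulVec (x k)))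
    (hy : ∀ k : ℕ, y (k + 1) = y k + ρ • (D.mulVec (x (k + 1)) - C.mulVec (z (k + 1))))
    (hy0 : y 0 = ρ • (D - C * E⁻¹ * Cᵀ).mulVec (x 0))
    (xstar rstar : Fin N → ℝ)
    (hKKT : gradF xstar = -(ρ • Q.mulVec rstar))
    (hQxstar : Q.mulVec xstar = 0) :
    let r : ℕ → Fin N → ℝ := fun k => ∑ t ∈ Finset.range (k + 1), Q.mulVec (x t)
    let Gsq : (Fin N → ℝ) → (Fin N → ℝ) → ℝ :=
      fun a b => a ⬝ᵥ a + b ⬝ᵥ (C * E⁻¹ * Cᵀ).mulVec b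
    ∀ k : ℕ, (2 / ρ) * ((x (k + 1) - xstar) ⬝ᵥ (gradF (x (k + 1)) - gradF xstar))
      = Gsq (r k - rstar) (x k - xstar)
        - Gsq (r (k + 1) - rstar) (x (k + 1) - xstar)
        - Gsq (r (k + 1) - r k) (x (k + 1) - x k) := by
  intro r Gsq k
  set S := C * E⁻¹ * Cᵀ with hS
  have hSsymm : S.IsSymm := by
    have hEsymm : E⁻¹.IsSymm := by
      rw [IsSymm, transpose_nonsing_inv, hE, diagonal_transpose]
    rw [IsSymm, hS, transpose_mul, transpose_mul, transpose_transpose, hEsymm.eq,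
      Matrix.mul_assoc]
  have hQsymm : Q.IsSymm := by
    simpa [IsSymm] using hQpsd.isHermitian.eq
  have hDx (v : Fin N → ℝ) : D *ᵥ v = S *ᵥ v + Q *ᵥ (Q *ᵥ v) := by
    rw [mulVec_mulVec, hQsq, sub_mulVec]
    abel
  have hCz (k : ℕ) : C *ᵥ z k = S *ᵥ x k := by
    rw [hz, mulVec_mulVec, mulVec_mulVec]
  have hr (k : ℕ) : r (k + 1) = r k + Q *ᵥ x (k + 1) := Finset.sum_range_succ _ _
  have hyr (k : ℕ) : y k = ρ • Q *ᵥ r k := by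
    induction k with
    | zero => simp [r, hy0, ← hQsq, mulVec_mulVec]
    | succ k ih =>
      rw [hy, ih, hr, hDx, hCz, mulVec_add, smul_add, add_sub_cancel_left]
  have hgradF : gradF (x (k + 1)) - gradF xstar
      = -ρ • (S *ᵥ (x (k + 1) - x k) + Q *ᵥ (r (k + 1) - rstar)) := by
    have h := eq_sub_of_add_eq (hx k)
    rw [h, hKKT, hyr, hDx, hCz, hr, mulVec_sub, mulVec_sub, mulVec_add]
    module
  have hQx : (x (k + 1) - xstar) ⬝ᵥ Q *ᵥ (r (k + 1) - rstar)
      = (r (k + 1) - rstar) ⬝ᵥ (r (k + 1) - r k) := by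
    rw [dotProduct_mulVec_comm_of_isSymm hQsymm, mulVec_sub, hQxstar, sub_zero, hr k,
      add_sub_cancel_left]
  have hquadx := quadForm_three_point hSsymm (x k) (x (k + 1)) xstar
  have hquadr := quadForm_three_point isSymm_one (r k) (r (k + 1)) rstar
  simp only [one_mulVec] at hquadr
  rw [hgradF, dotProduct_smul, dotProduct_add, hQx, smul_eq_mul]
  have hρ' : 2 / ρ * (-ρ * ((x (k + 1) - xstar) ⬝ᵥ S *ᵥ (x (k + 1) - x k)
      + (r (k + 1) - rstar) ⬝ᵥ (r (k + 1) - r k)))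
      = -2 * ((x (k + 1) - xstar) ⬝ᵥ S *ᵥ (x (k + 1) - x k)
      + (r (k + 1) - rstar) ⬝ᵥ (r (k + 1) - r k)) := by
    field_simp
  rw [hρ']
  simp only [Gsq]
  linarith
end

section
/- Under the H-CADMM recursion with KKT point (x*, r*) satisfying additionally Q x* = 0, if F is σ-strongly convex with σ > 0, then for every k ≥ 0: (2σ/ρ) ‖x^{k+1} − x*‖² ≤ ‖q^k − q*‖_G² − ‖q^{k+1} − q*‖_G² − ‖q^{k+1} − q^k‖_G². -/
open Matrix

/-- Polarization of the quadratic form of a symmetric matrix. -/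
theorem Matrix.IsSymm.dotProduct_mulVec_polarization {n : Type*} [Fintype n]
    {A : Matrix n n ℝ} (hA : A.IsSymm) (a b : n → ℝ) :
    b ⬝ᵥ A *ᵥ b - a ⬝ᵥ A *ᵥ a - (a - b) ⬝ᵥ A *ᵥ (a - b) = 2 * (a ⬝ᵥ A *ᵥ (b - a)) := by
  have hab : b ⬝ᵥ A *ᵥ a = a ⬝ᵥ A *ᵥ b := by
    rw [dotProduct_comm, ← vecMul_transpose, hA.eq, dotProduct_mulVec]
  simp only [mulVec_sub, dotProduct_sub, sub_dotProduct, hab]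
  ring

/-- The strong-convexity inequality in the proof of Theorem 1 of the H-CADMM paper:
`(2σ/ρ)‖x^{k+1} − x*‖² ≤ ‖q^k − q*‖²_G − ‖q^{k+1} − q*‖²_G − ‖q^{k+1} − q^k‖²_G`. -/
theorem stmt_18 (N M : ℕ) (C : Matrix (Fin N) (Fin M) ℝ)
    (hC01 : ∀ i j, C i j = 0 ∨ C i j = 1)
    (hd : ∀ i, 0 < ∑ j, C i j)
    (he : ∀ j, (2 : ℝ) ≤ ∑ i, C i j)
    (D : Matrix (Fin N) (Fin N) ℝ) (hD : D = Matrix.diagonal fun i => ∑ j, C i j)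
    (E : Matrix (Fin M) (Fin M) ℝ) (hE : E = Matrix.diagonal fun j => ∑ i, C i j)
    (Q : Matrix (Fin N) (Fin N) ℝ)
    (hQpsd : Q.PosSemidef) (hQsq : Q * Q = D - C * E⁻¹ * Cᵀ)
    (ρ : ℝ) (hρ : 0 < ρ)
    (F : (Fin N → ℝ) → ℝ) (gradF : (Fin N → ℝ) → Fin N → ℝ)
    (hFdiff : Differentiable ℝ F)
    (hgrad : ∀ x v, fderiv ℝ F x v = ∑ i, gradF x i * v i)
    (x : ℕ → Fin N → ℝ) (z : ℕ → Fin M → ℝ) (y : ℕ → Fin N → ℝ)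
    (hx : ∀ k : ℕ, gradF (x (k + 1)) + ρ • D.mulVec (x (k + 1))
      = ρ • C.mulVec (z k) - y k)
    (hz : ∀ k : ℕ, z k = E⁻¹.mulVec (Cᵀ.mulVec (x k)))
    (hy : ∀ k : ℕ, y (k + 1) = y k + ρ • (D.mulVec (x (k + 1)) - C.mulVec (z (k + 1))))
    (hy0 : y 0 = ρ • (D - C * E⁻¹ * Cᵀ).mulVec (x 0))
    (xstar rstar : Fin N → ℝ)
    (hKKT : gradF xstar = -(ρ • Q.mulVec rstar))
    (hQxstar : Q.mulVec xstar = 0)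
    (σ : ℝ) (hσ : 0 < σ)
    -- σ-strong convexity of F (Euclidean inner product form)
    (hsc : ∀ a b : Fin N → ℝ, σ * ((a - b) ⬝ᵥ (a - b)) ≤ (a - b) ⬝ᵥ (gradF a - gradF b)) :
    let r : ℕ → Fin N → ℝ := fun k => ∑ t ∈ Finset.range (k + 1), Q.mulVec (x t)
    let Gsq : (Fin N → ℝ) → (Fin N → ℝ) → ℝ :=
      fun a b => a ⬝ᵥ a + b ⬝ᵥ (C * E⁻¹ * Cᵀ).mulVec b
    ∀ k : ℕ, (2 * σ / ρ) * ((x (k + 1) - xstar) ⬝ᵥ (x (k + 1) - xstar))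
      ≤ Gsq (r k - rstar) (x k - xstar)
        - Gsq (r (k + 1) - rstar) (x (k + 1) - xstar)
        - Gsq (r (k + 1) - r k) (x (k + 1) - x k) := by
  intro r Gsq k
  set W := C * E⁻¹ * Cᵀ with hW
  have hWsymm : W.IsSymm := by
    have hEsymm : Eᵀ = E := by rw [hE, diagonal_transpose]
    rw [IsSymm, hW, transpose_mul, transpose_mul, transpose_transpose, transpose_nonsing_inv,
      hEsymm, Matrix.mul_assoc]
  have hQsymm : Qᵀ = Q := by
    simpa [conjTranspose_eq_transpose_of_trivial] using hQpsd.isHermitian.eq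
  have hCz : ∀ m, C *ᵥ z m = W *ᵥ x m := fun m => by
    rw [hz, mulVec_mulVec, mulVec_mulVec, hW, Matrix.mul_assoc]
  have hD' : ∀ v, D *ᵥ v = Q *ᵥ Q *ᵥ v + W *ᵥ v := fun v => by
    rw [mulVec_mulVec, hQsq, sub_mulVec, sub_add_cancel]
  have hr : ∀ m, r (m + 1) = r m + Q *ᵥ x (m + 1) := fun m => Finset.sum_range_succ _ _
  have hyr : ∀ m, y m = ρ • Q *ᵥ r m := by
    intro m
    induction m with
    | zero => simp [r, hy0, ← hQsq, mulVec_mulVec]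
    | succ m ih =>
      rw [hy, ih, hCz, hD', hr, mulVec_add, add_sub_cancel_right, smul_add]
  have hgrad_sub : gradF (x (k + 1)) - gradF xstar
      = ρ • (W *ᵥ (x k - x (k + 1)) - Q *ᵥ (r (k + 1) - rstar)) := by
    have h := hx k
    rw [hCz, hyr, hD'] at h
    rw [eq_sub_of_add_eq h, hKKT, hr]
    simp only [mulVec_sub, mulVec_add]
    module
  have hQu : Q *ᵥ (x (k + 1) - xstar) = r (k + 1) - r k := by
    rw [mulVec_sub, hQxstar, hr, sub_zero, add_sub_cancel_left]
  have hQadj : (x (k + 1) - xstar) ⬝ᵥ Q *ᵥ (r (k + 1) - rstar)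
      = (r (k + 1) - r k) ⬝ᵥ (r (k + 1) - rstar) := by
    rw [dotProduct_mulVec, ← mulVec_transpose, hQsymm, hQu]
  have hmono := hsc (x (k + 1)) xstar
  rw [hgrad_sub, dotProduct_smul, smul_eq_mul, dotProduct_sub _ (W *ᵥ _), hQadj] at hmono
  have hpolW := hWsymm.dotProduct_mulVec_polarization (x (k + 1) - xstar) (x k - xstar)
  have hpolr := (isSymm_one (n := Fin N) (α := ℝ)).dotProduct_mulVec_polarization
    (r (k + 1) - rstar) (r k - rstar)
  simp only [one_mulVec, sub_sub_sub_cancel_right] at hpolW hpolr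
  rw [← neg_sub (r (k + 1)) (r k), dotProduct_neg,
    dotProduct_comm (r (k + 1) - rstar) (r (k + 1) - r k)] at hpolr
  rw [div_mul_eq_mul_div, div_le_iff₀ hρ]
  have hG : Gsq (r k - rstar) (x k - xstar) - Gsq (r (k + 1) - rstar) (x (k + 1) - xstar)
      - Gsq (r (k + 1) - r k) (x (k + 1) - x k)
      = 2 * ((x (k + 1) - xstar) ⬝ᵥ W *ᵥ (x k - x (k + 1))
        - (r (k + 1) - r k) ⬝ᵥ (r (k + 1) - rstar)) := by
    simp only [Gsq]
    linarith
  rw [hG]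
  linarith
end

section
/- Under the H-CADMM recursion with KKT point (x*, r*) satisfying additionally Q x* = 0, if F is convex and ∇F is L-Lipschitz with L > 0, then for every k ≥ 0: (2/(ρL)) ‖∇F(x^{k+1}) − ∇F(x*)‖² ≤ ‖q^k − q*‖_G² − ‖q^{k+1} − q*‖_G² − ‖q^{k+1} − q^k‖_G². -/
open Matrix

section CoCoercivity

variable {n : Type*} [Fintype n] {F : (n → ℝ) → ℝ} {g : (n → ℝ) → n → ℝ}

theorem hasDerivAt_comp_line (hF : Differentiable ℝ F)
    (hg : ∀ x v, fderiv ℝ F x v = g x ⬝ᵥ v) (a v : n → ℝ) (t : ℝ) :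
    HasDerivAt (fun t : ℝ => F (a + t • v)) (g (a + t • v) ⬝ᵥ v) t := by
  have hline : HasDerivAt (fun t : ℝ => a + t • v) v t := by
    simpa using ((hasDerivAt_id t).smul_const v).const_add a
  rw [← hg]
  exact (hF (a + t • v)).hasFDerivAt.comp_hasDerivAt t hline

theorem ConvexOn.add_dotProduct_le (hF : Differentiable ℝ F)
    (hg : ∀ x v, fderiv ℝ F x v = g x ⬝ᵥ v) (hconv : ConvexOn ℝ Set.univ F) (a b : n → ℝ) :
    F a + g a ⬝ᵥ (b - a) ≤ F b := by
  have hline : ConvexOn ℝ Set.univ (fun t : ℝ => F (a + t • (b - a))) := by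
    have h := hconv.comp_affineMap (AffineMap.lineMap a b : ℝ →ᵃ[ℝ] (n → ℝ))
    simpa [Function.comp_def, AffineMap.lineMap_apply, add_comm] using h
  have h := hline.le_slope_of_hasDerivAt (Set.mem_univ 0) (Set.mem_univ 1) one_pos
    (hasDerivAt_comp_line hF hg a (b - a) 0)
  simp only [slope_def_field, zero_smul, one_smul, add_zero, add_sub_cancel, sub_zero,
    div_one] at h
  linarith

/-- The descent lemma for a function whose gradient is `L`-Lipschitz. -/
theorem le_add_dotProduct_add_of_lipschitz_gradient (hF : Differentiable ℝ F)
    (hg : ∀ x v, fderiv ℝ F x v = g x ⬝ᵥ v) {L : ℝ} (hL : 0 < L)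
    (hLip : ∀ a b, (g a - g b) ⬝ᵥ (g a - g b) ≤ L ^ 2 * ((a - b) ⬝ᵥ (a - b))) (a v : n → ℝ) :
    F (a + v) ≤ F a + g a ⬝ᵥ v + L / 2 * (v ⬝ᵥ v) := by
  have hderiv (t : ℝ) : HasDerivAt
      (fun t : ℝ => F (a + t • v) - t * (g a ⬝ᵥ v) - L / 2 * (v ⬝ᵥ v) * t ^ 2)
      (g (a + t • v) ⬝ᵥ v - g a ⬝ᵥ v - L / 2 * (v ⬝ᵥ v) * (2 * t)) t := by
    have h := ((hasDerivAt_comp_line hF hg a v t).fun_sub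
      ((hasDerivAt_id t).mul_const (g a ⬝ᵥ v))).fun_sub
      ((hasDerivAt_pow 2 t).const_mul (L / 2 * (v ⬝ᵥ v)))
    simpa using h
  have hanti : AntitoneOn
      (fun t : ℝ => F (a + t • v) - t * (g a ⬝ᵥ v) - L / 2 * (v ⬝ᵥ v) * t ^ 2)
      (Set.Icc 0 1) := by
    refine antitoneOn_of_deriv_nonpos (convex_Icc 0 1)
      (fun t _ => (hderiv t).continuousAt.continuousWithinAt)
      (fun t _ => (hderiv t).differentiableAt.differentiableWithinAt) fun t ht => ?_
    rw [interior_Icc] at ht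
    rw [(hderiv t).deriv]
    have hlip := hLip (a + t • v) a
    have hsq := dotProduct_star_self_nonneg (g (a + t • v) - g a - (L * t) • v)
    simp only [star_trivial, add_sub_cancel_left, dotProduct_sub, sub_dotProduct, smul_dotProduct,
      dotProduct_smul, smul_eq_mul, dotProduct_comm v] at hlip hsq ⊢
    have hLt : 0 < L * t := mul_pos hL ht.1
    refine nonpos_of_mul_nonpos_right (a := L * t) ?_ hLt
    linarith
  have h := hanti (Set.left_mem_Icc.2 zero_le_one) (Set.right_mem_Icc.2 zero_le_one) zero_le_one
  simp only [one_smul, zero_smul, add_zero] at h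
  linarith

/-- The Baillon–Haddad inequality. -/
theorem ConvexOn.gradient_cocoercive (hF : Differentiable ℝ F)
    (hg : ∀ x v, fderiv ℝ F x v = g x ⬝ᵥ v) (hconv : ConvexOn ℝ Set.univ F) {L : ℝ} (hL : 0 < L)
    (hLip : ∀ a b, (g a - g b) ⬝ᵥ (g a - g b) ≤ L ^ 2 * ((a - b) ⬝ᵥ (a - b))) (a b : n → ℝ) :
    1 / L * ((g a - g b) ⬝ᵥ (g a - g b)) ≤ (a - b) ⬝ᵥ (g a - g b) := by
  have gap (a b : n → ℝ) :
      F a + g a ⬝ᵥ (b - a) + 1 / (2 * L) * ((g b - g a) ⬝ᵥ (g b - g a)) ≤ F b := by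
    have hlow := hconv.add_dotProduct_le hF hg a (b + (-(1 / L)) • (g b - g a))
    have hup := le_add_dotProduct_add_of_lipschitz_gradient hF hg hL hLip b
      ((-(1 / L)) • (g b - g a))
    rw [add_sub_right_comm, dotProduct_add] at hlow
    have hsplit : g b ⬝ᵥ (g b - g a)
        = g a ⬝ᵥ (g b - g a) + (g b - g a) ⬝ᵥ (g b - g a) := by
      rw [← add_dotProduct, add_sub_cancel]
    simp only [dotProduct_smul, smul_dotProduct, smul_eq_mul, hsplit] at hlow hup
    generalize (g b - g a) ⬝ᵥ (g b - g a) = s at *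
    have hcoef : L / 2 * (-(1 / L) * (-(1 / L) * s)) = 1 / (2 * L) * s := by
      field_simp
    have hcoef' : 1 / L * s = 2 * (1 / (2 * L) * s) := by
      field_simp
    linarith
  have hab := gap a b
  have hba := gap b a
  have hhalf : 1 / L = 2 * (1 / (2 * L)) := by field_simp
  rw [hhalf]
  rw [← neg_sub (g a) (g b), neg_dotProduct_neg, ← neg_sub a b, dotProduct_neg] at hab
  rw [dotProduct_comm (a - b), sub_dotProduct _ _ (a - b)]
  linarith

end CoCoercivity

/-- For a symmetric bilinear form, `‖u‖² - ‖v‖² - ‖v - u‖² = 2⟨v, u - v⟩`. -/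
theorem Matrix.IsSymm.dotProduct_mulVec_sub_sub {n : Type*} [Fintype n] {A : Matrix n n ℝ}
    (hA : A.IsSymm) (u v : n → ℝ) :
    u ⬝ᵥ A *ᵥ u - v ⬝ᵥ A *ᵥ v - (v - u) ⬝ᵥ A *ᵥ (v - u) = 2 * (v ⬝ᵥ A *ᵥ (u - v)) := by
  have hcomm : u ⬝ᵥ A *ᵥ v = v ⬝ᵥ A *ᵥ u := by
    rw [dotProduct_mulVec, ← mulVec_transpose, hA.eq, dotProduct_comm]
  simp only [mulVec_sub, dotProduct_sub, sub_dotProduct, hcomm]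
  ring

/-- The co-coercivity inequality in the proof of Theorem 1 of the H-CADMM paper:
`(2/(ρL))‖∇F(x^{k+1}) − ∇F(x*)‖² ≤ ‖q^k − q*‖²_G − ‖q^{k+1} − q*‖²_G − ‖q^{k+1} − q^k‖²_G`. -/
theorem stmt_19 (N M : ℕ) (C : Matrix (Fin N) (Fin M) ℝ)
    (hC01 : ∀ i j, C i j = 0 ∨ C i j = 1)
    (hd : ∀ i, 0 < ∑ j, C i j)
    (he : ∀ j, (2 : ℝ) ≤ ∑ i, C i j)
    (D : Matrix (Fin N) (Fin N) ℝ) (hD : D = Matrix.diagonal fun i => ∑ j, C i j)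
    (E : Matrix (Fin M) (Fin M) ℝ) (hE : E = Matrix.diagonal fun j => ∑ i, C i j)
    (Q : Matrix (Fin N) (Fin N) ℝ)
    (hQpsd : Q.PosSemidef) (hQsq : Q * Q = D - C * E⁻¹ * Cᵀ)
    (ρ : ℝ) (hρ : 0 < ρ)
    (F : (Fin N → ℝ) → ℝ) (gradF : (Fin N → ℝ) → Fin N → ℝ)
    (hFdiff : Differentiable ℝ F)
    (hgrad : ∀ x v, fderiv ℝ F x v = ∑ i, gradF x i * v i)
    (x : ℕ → Fin N → ℝ) (z : ℕ → Fin M → ℝ) (y : ℕ → Fin N → ℝ)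
    (hx : ∀ k : ℕ, gradF (x (k + 1)) + ρ • D.mulVec (x (k + 1))
      = ρ • C.mulVec (z k) - y k)
    (hz : ∀ k : ℕ, z k = E⁻¹.mulVec (Cᵀ.mulVec (x k)))
    (hy : ∀ k : ℕ, y (k + 1) = y k + ρ • (D.mulVec (x (k + 1)) - C.mulVec (z (k + 1))))
    (hy0 : y 0 = ρ • (D - C * E⁻¹ * Cᵀ).mulVec (x 0))
    (xstar rstar : Fin N → ℝ)
    (hKKT : gradF xstar = -(ρ • Q.mulVec rstar))
    (hQxstar : Q.mulVec xstar = 0)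
    (L : ℝ) (hL : 0 < L)
    -- convexity of F
    (hconv : ConvexOn ℝ Set.univ F)
    -- L-Lipschitz gradient of F (squared Euclidean norm form)
    (hLip : ∀ a b : Fin N → ℝ,
      (gradF a - gradF b) ⬝ᵥ (gradF a - gradF b) ≤ L ^ 2 * ((a - b) ⬝ᵥ (a - b))) :
    let r : ℕ → Fin N → ℝ := fun k => ∑ t ∈ Finset.range (k + 1), Q.mulVec (x t)
    let Gsq : (Fin N → ℝ) → (Fin N → ℝ) → ℝ :=
      fun a b => a ⬝ᵥ a + b ⬝ᵥ (C * E⁻¹ * Cᵀ).mulVec b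
    ∀ k : ℕ, (2 / (ρ * L))
        * ((gradF (x (k + 1)) - gradF xstar) ⬝ᵥ (gradF (x (k + 1)) - gradF xstar))
      ≤ Gsq (r k - rstar) (x k - xstar)
        - Gsq (r (k + 1) - rstar) (x (k + 1) - xstar)
        - Gsq (r (k + 1) - r k) (x (k + 1) - x k) := by
  intro r Gsq k
  set A : Matrix (Fin N) (Fin N) ℝ := C * E⁻¹ * Cᵀ with hA
  have hAsymm : A.IsSymm := by
    rw [Matrix.IsSymm, hA, transpose_mul, transpose_mul, transpose_transpose,
      transpose_nonsing_inv, hE, diagonal_transpose, Matrix.mul_assoc]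
  have hQsymm : Q.IsSymm := by
    simpa [Matrix.IsHermitian, Matrix.IsSymm] using hQpsd.isHermitian
  have hCz (k : ℕ) : C *ᵥ z k = A *ᵥ x k := by
    rw [hz, mulVec_mulVec, mulVec_mulVec]
  have hr (k : ℕ) : r (k + 1) = r k + Q *ᵥ x (k + 1) := Finset.sum_range_succ _ _
  have hyr (k : ℕ) : y k = ρ • Q *ᵥ r k := by
    induction k with
    | zero => simp [r, hy0, hQsq]
    | succ k ih =>
      rw [hy, ih, hr, hCz, ← sub_mulVec, ← hQsq, mulVec_add, mulVec_mulVec, smul_add]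
  have hg : gradF (x (k + 1)) - gradF xstar
      = ρ • (A *ᵥ (x k - x (k + 1)) - Q *ᵥ (r (k + 1) - rstar)) := by
    have hstep := hx k
    rw [hCz, hyr, ← sub_add_cancel D A, ← hQsq] at hstep
    rw [hKKT, eq_sub_of_add_eq hstep, hr]
    simp only [add_mulVec, mulVec_add, mulVec_sub, mulVec_mulVec]
    module
  have hcross : (x (k + 1) - xstar) ⬝ᵥ Q *ᵥ (r (k + 1) - rstar)
      = (r (k + 1) - rstar) ⬝ᵥ (r (k + 1) - r k) := by
    rw [dotProduct_mulVec, ← mulVec_transpose, hQsymm.eq, mulVec_sub, hQxstar, sub_zero, hr,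
      add_sub_cancel_left, dotProduct_comm]
  have hco := hconv.gradient_cocoercive hFdiff hgrad hL hLip (x (k + 1)) xstar
  have hAid := hAsymm.dotProduct_mulVec_sub_sub (x k - xstar) (x (k + 1) - xstar)
  have hIid := (isSymm_one (n := Fin N) (α := ℝ)).dotProduct_mulVec_sub_sub
    (r k - rstar) (r (k + 1) - rstar)
  simp only [one_mulVec, sub_sub_sub_cancel_right] at hAid hIid
  rw [← neg_sub (r (k + 1)) (r k), dotProduct_neg] at hIid
  calc (2 / (ρ * L)) * ((gradF (x (k + 1)) - gradF xstar) ⬝ᵥ (gradF (x (k + 1)) - gradF xstar))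
      = 2 / ρ * (1 / L *
        ((gradF (x (k + 1)) - gradF xstar) ⬝ᵥ (gradF (x (k + 1)) - gradF xstar))) := by
        field_simp
    _ ≤ 2 / ρ * ((x (k + 1) - xstar) ⬝ᵥ (gradF (x (k + 1)) - gradF xstar)) := by gcongr
    _ = 2 * ((x (k + 1) - xstar) ⬝ᵥ A *ᵥ (x k - x (k + 1))
        - (r (k + 1) - rstar) ⬝ᵥ (r (k + 1) - r k)) := by
        rw [hg, dotProduct_smul, dotProduct_sub, hcross, smul_eq_mul]
        field_simp
    _ = _ := by
        simp only [Gsq]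
        linarith
end
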